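/- Let n ∈ ℕ, s ∈ (1, n+1)\ℕ and let A be a Young function with ∫_0 (t/A(t))^{(s−1)/(n+1−s)} dt < ∞. If φ is an admissible function and c > 0 is a constant such that |u|_{𝓛^{φ}(ℝⁿ)} ≤ c |∇^{[s]}u|_{{s},A,ℝⁿ} for every u ∈ V^{s,A}_{d,1}(ℝⁿ), then there exists a constant c' > 0 such that ψ_{s,A}(r) ≤ c' φ(r) for all r > 0. Hence 𝓛^{ψ_{s,A}}(ℝⁿ) is the optimal Campanato target space for the embedding of V^{s,A}_{d,1}(ℝⁿ). -/

import Mathlib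

open MeasureTheory Metric Set Filter
open scoped ENNReal Topology

noncomputable section

/-- Euclidean space `ℝⁿ`. -/
abbrev Euc (n : ℕ) := EuclideanSpace ℝ (Fin n)

/-- A Young function: convex, left-continuous, vanishing at `0`,
non-constant on `(0,∞)`, with values in `[0,∞]`. -/
def IsYoung (A : ℝ → ℝ≥0∞) : Prop :=
  A 0 = 0 ∧
  (∀ x y t : ℝ, 0 ≤ x → 0 ≤ y → 0 ≤ t → t ≤ 1 →
      A (t * x + (1 - t) * y) ≤ ENNReal.ofReal t * A x + ENNReal.ofReal (1 - t) * A y) ∧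
  (∀ t : ℝ, 0 < t → ContinuousWithinAt A (Set.Iic t) t) ∧
  (∃ t₁ t₂ : ℝ, 0 < t₁ ∧ 0 < t₂ ∧ A t₁ ≠ A t₂)

/-- The right-continuous generalized inverse of a monotone function `A : [0,∞) → [0,∞]`. -/
def rcInv (A : ℝ → ℝ≥0∞) (v : ℝ≥0∞) : ℝ :=
  sInf {τ : ℝ | 0 ≤ τ ∧ v < A τ}

/-- The Young conjugate `Ã(t) = sup {τ t - A(τ) : τ ≥ 0}`. -/
def youngConj (A : ℝ → ℝ≥0∞) (t : ℝ) : ℝ≥0∞ :=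
  ⨆ (τ : ℝ) (_ : 0 ≤ τ), ENNReal.ofReal (τ * t) - A τ

/-- The functional `J_{σ,A}(v)` for a vector-valued `v`, with the Euclidean norm. -/
def Jfun (n : ℕ) (σ : ℝ) (A : ℝ → ℝ≥0∞) {ι : Type} [Fintype ι]
    (v : Euc n → ι → ℝ) : ℝ≥0∞ :=
  ∫⁻ x : Euc n, ∫⁻ y : Euc n,
    A (Real.sqrt (∑ i, (v x i - v y i) ^ 2) / ‖x - y‖ ^ σ) /
      ENNReal.ofReal (‖x - y‖ ^ (n : ℝ))

/-- The fractional Orlicz–Sobolev seminorm `|v|_{σ,A,ℝⁿ}` (vector-valued version). -/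
def fracSem (n : ℕ) (σ : ℝ) (A : ℝ → ℝ≥0∞) {ι : Type} [Fintype ι]
    (v : Euc n → ι → ℝ) : ℝ≥0∞ :=
  sInf (ENNReal.ofReal '' {lam : ℝ | 0 < lam ∧ Jfun n σ A (fun x i => v x i / lam) ≤ 1})

/-- The fractional Orlicz–Sobolev seminorm `|u|_{σ,A,ℝⁿ}` of a scalar function. -/
def fracSemS (n : ℕ) (σ : ℝ) (A : ℝ → ℝ≥0∞) (u : Euc n → ℝ) : ℝ≥0∞ :=
  fracSem n σ A (fun x (_ : Fin 1) => u x)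

/-- The normalized mean oscillation `φ(|B|^{1/n})⁻¹ ⨍_B |u - u_B|` over the ball `B = B(x,r)`. -/
def oscQuot (n : ℕ) (φ : ℝ → ℝ) (u : Euc n → ℝ) (x : Euc n) (r : ℝ) : ℝ :=
  (φ ((volume (ball x r)).toReal ^ ((n : ℝ)⁻¹)))⁻¹ *
    ⨍ y in ball x r, |u y - ⨍ z in ball x r, u z|

/-- The Campanato seminorm `|u|_{𝓛^φ(ℝⁿ)}`. -/
def campSem (n : ℕ) (φ : ℝ → ℝ) (u : Euc n → ℝ) : ℝ≥0∞ :=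
  ⨆ (x : Euc n) (r : ℝ) (_ : 0 < r), ENNReal.ofReal (oscQuot n φ u x r)

/-- The Campanato quantity restricted to balls of measure at most `r`. -/
def campSemSmall (n : ℕ) (φ : ℝ → ℝ) (u : Euc n → ℝ) (r : ℝ) : ℝ≥0∞ :=
  ⨆ (x : Euc n) (ρ : ℝ) (_ : 0 < ρ) (_ : volume (ball x ρ) ≤ ENNReal.ofReal r),
    ENNReal.ofReal (oscQuot n φ u x ρ)

/-- `φ : (0,∞) → (0,∞)` is admissible: positive and bounded below away from zero on `[a,∞)`. -/
def Admissible (φ : ℝ → ℝ) : Prop :=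
  (∀ r : ℝ, 0 < r → 0 < φ r) ∧
  ∀ a : ℝ, 0 < a → ∃ ε : ℝ, 0 < ε ∧ ∀ r : ℝ, a ≤ r → ε ≤ φ r

/-- `φ_{s,A}(r) = r^s A⁻¹(r^{-n})`. -/
def phiSA (n : ℕ) (s : ℝ) (A : ℝ → ℝ≥0∞) (r : ℝ) : ℝ :=
  r ^ s * rcInv A (ENNReal.ofReal (r ^ (-(n : ℝ))))

/-- `u` is `m`-times weakly differentiable, with iterated weak partial
derivatives recorded by `D`. -/
def HasWeakDerivs (n m : ℕ) (u : Euc n → ℝ)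
    (D : (h : ℕ) → Euc n → (Fin h → Fin n) → ℝ) : Prop :=
  (∀ x d, D 0 x d = u x) ∧
  ∀ h : ℕ, h ≤ m → ∀ dirs : Fin h → Fin n,
    LocallyIntegrable (fun x => D h x dirs) volume ∧
    ∀ φ : Euc n → ℝ, ContDiff ℝ (⊤ : ℕ∞) φ → HasCompactSupport φ →
      ∫ x : Euc n, u x *
          iteratedFDeriv ℝ h φ x (fun i => EuclideanSpace.single (dirs i) (1 : ℝ)) =
        (-1 : ℝ) ^ h * ∫ x : Euc n, D h x dirs * φ x

/-- The Euclidean length `|∇^h u|(x)` of the `h`-th order weak gradient. -/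
def gradLen (n : ℕ) (D : (h : ℕ) → Euc n → (Fin h → Fin n) → ℝ) (h : ℕ) (x : Euc n) : ℝ :=
  Real.sqrt (∑ d : Fin h → Fin n, (D h x d) ^ 2)

/-- The derivatives of orders `k, …, m` decay near infinity:
`|{|∇^h u| > t}| < ∞` for every `t > 0`. -/
def DecayFrom (n k m : ℕ) (D : (h : ℕ) → Euc n → (Fin h → Fin n) → ℝ) : Prop :=
  ∀ h : ℕ, k ≤ h → h ≤ m → ∀ t : ℝ, 0 < t →
    volume {x : Euc n | t < gradLen n D h x} < ⊤

/-- The Young function `F_k(t) = t^{n/(n-s+k+1)} ∫_0^t Ã(τ) τ^{-1-n/(n-s+k+1)} dτ`. -/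
def Fk (n : ℕ) (s : ℝ) (k : ℕ) (A : ℝ → ℝ≥0∞) (t : ℝ) : ℝ≥0∞ :=
  ENNReal.ofReal (t ^ ((n : ℝ) / ((n : ℝ) - s + (k : ℝ) + 1))) *
    ∫⁻ τ in Set.Ioc (0 : ℝ) t,
      youngConj A τ * ENNReal.ofReal (τ ^ (-1 - (n : ℝ) / ((n : ℝ) - s + (k : ℝ) + 1)))

/-- `ψ^k_{s,A}(r) = 1 / (r^{n-s+k} F_k⁻¹(r^{-n}))`. -/
def psiK (n : ℕ) (s : ℝ) (k : ℕ) (A : ℝ → ℝ≥0∞) (r : ℝ) : ℝ :=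
  (r ^ ((n : ℝ) - s + (k : ℝ)) * rcInv (Fk n s k A) (ENNReal.ofReal (r ^ (-(n : ℝ)))))⁻¹

/-- `ψ^{[s]}_{s,A}(r) = r^{{s}} A⁻¹(r^{-n})`. -/
def psiTop (n : ℕ) (s : ℝ) (A : ℝ → ℝ≥0∞) (r : ℝ) : ℝ :=
  r ^ (s - (⌊s⌋₊ : ℝ)) * rcInv A (ENNReal.ofReal (r ^ (-(n : ℝ))))

/-- Convergence near zero of `∫_0 (t/A(t))^{(s-(k+1))/(n-(s-(k+1)))} dt`. -/
def IntCondK (n : ℕ) (s : ℝ) (k : ℕ) (A : ℝ → ℝ≥0∞) : Prop :=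
  ∃ ε : ℝ, 0 < ε ∧
    ∫⁻ t in Set.Ioc (0 : ℝ) ε,
      (ENNReal.ofReal t / A t) ^ ((s - (k : ℝ) - 1) / ((n : ℝ) - (s - (k : ℝ) - 1))) < ⊤

/-- `P` is the projection polynomial `P^k_B[u]`: it has degree at most `k` and its
derivatives up to order `k` match, in the mean over `B`, the weak derivatives `D` of `u`. -/
def IsCampPoly (n k : ℕ) (D : (h : ℕ) → Euc n → (Fin h → Fin n) → ℝ)
    (B : Set (Euc n)) (P : MvPolynomial (Fin n) ℝ) : Prop :=
  P.totalDegree ≤ k ∧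
  ∀ h : ℕ, h ≤ k → ∀ dirs : Fin h → Fin n,
    ∫ x in B, D h x dirs =
      ∫ x in B,
        iteratedFDeriv ℝ h (fun y : Euc n => MvPolynomial.eval (fun i => y i) P) x
          (fun i => EuclideanSpace.single (dirs i) (1 : ℝ))

/-- The normalized oscillation of order `k` over the ball `B(x,r)`. -/
def oscQuotK (n k : ℕ) (φ : ℝ → ℝ) (u : Euc n → ℝ)
    (D : (h : ℕ) → Euc n → (Fin h → Fin n) → ℝ) (x : Euc n) (r : ℝ) : ℝ≥0∞ :=
  ⨅ (P : MvPolynomial (Fin n) ℝ) (_ : IsCampPoly n k D (ball x r) P),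
    ENNReal.ofReal
      ((φ ((volume (ball x r)).toReal ^ ((n : ℝ)⁻¹)) *
          (volume (ball x r)).toReal ^ ((k : ℝ) / (n : ℝ)))⁻¹ *
        ⨍ y in ball x r, |u y - MvPolynomial.eval (fun i => y i) P|)

/-- The `k`-th order Campanato seminorm `|u|_{𝓛^{k,φ}(ℝⁿ)}`. -/
def campSemK (n k : ℕ) (φ : ℝ → ℝ) (u : Euc n → ℝ)
    (D : (h : ℕ) → Euc n → (Fin h → Fin n) → ℝ) : ℝ≥0∞ :=
  ⨆ (x : Euc n) (r : ℝ) (_ : 0 < r), oscQuotK n k φ u D x r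

/-- The `k`-th order Campanato quantity restricted to balls of measure at most `r`. -/
def campSemKSmall (n k : ℕ) (φ : ℝ → ℝ) (u : Euc n → ℝ)
    (D : (h : ℕ) → Euc n → (Fin h → Fin n) → ℝ) (r : ℝ) : ℝ≥0∞ :=
  ⨆ (x : Euc n) (ρ : ℝ) (_ : 0 < ρ) (_ : volume (ball x ρ) ≤ ENNReal.ofReal r),
    oscQuotK n k φ u D x ρ

/-- The Luxemburg norm `‖f‖_{L^A(μ)}`. -/
def luxNorm {α : Type*} [MeasurableSpace α] (A : ℝ → ℝ≥0∞) (μ : Measure α)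
    (f : α → ℝ) : ℝ≥0∞ :=
  sInf (ENNReal.ofReal '' {lam : ℝ | 0 < lam ∧ ∫⁻ x, A (|f x| / lam) ∂μ ≤ 1})

/-- Iterated integral `∫_r^∞ ∫_{r_1}^∞ ⋯ g`. -/
def iterInt : ℕ → (ℝ → ℝ) → (ℝ → ℝ)
  | 0, g => g
  | j + 1, g => fun r => ∫ t in Set.Ioi r, iterInt j g t

end
/-! ### Young functions -/

theorem IsYoung.zero {A : ℝ → ℝ≥0∞} (hA : IsYoung A) : A 0 = 0 := hA.1

theorem IsYoung.scale {A : ℝ → ℝ≥0∞} (hA : IsYoung A) {a x : ℝ} (ha0 : 0 ≤ a) (ha1 : a ≤ 1)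
    (hx : 0 ≤ x) : A (a * x) ≤ ENNReal.ofReal a * A x := by
  simpa [hA.zero] using hA.2.1 x 0 a hx le_rfl ha0 ha1

theorem IsYoung.mono {A : ℝ → ℝ≥0∞} (hA : IsYoung A) {x y : ℝ} (hx : 0 ≤ x) (hxy : x ≤ y) :
    A x ≤ A y := by
  rcases hx.eq_or_lt with rfl | hx'
  · simp [hA.zero]
  have hy : 0 < y := hx'.trans_le hxy
  have h1 : x / y ≤ 1 := (div_le_one hy).2 hxy
  calc A x = A (x / y * y) := by rw [div_mul_cancel₀ _ hy.ne']
    _ ≤ ENNReal.ofReal (x / y) * A y := hA.scale (by positivity) h1 hy.le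
    _ ≤ 1 * A y := by gcongr; simpa using ENNReal.ofReal_le_ofReal h1
    _ = A y := one_mul _

/-- Jensen's inequality for a finite sum with sub-probability weights. -/
theorem IsYoung.jensen {A : ℝ → ℝ≥0∞} (hA : IsYoung A) {ι : Type*} (s : Finset ι)
    (w x : ι → ℝ) (hw : ∀ i, 0 ≤ w i) (hx : ∀ i, 0 ≤ x i) (hs : ∑ i ∈ s, w i ≤ 1) :
    A (∑ i ∈ s, w i * x i) ≤ ∑ i ∈ s, ENNReal.ofReal (w i) * A (x i) := by
  classical
  induction s using Finset.induction_on generalizing w with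
  | empty => simp [hA.zero]
  | insert a s ha ih =>
    rw [Finset.sum_insert ha] at hs ⊢
    rw [Finset.sum_insert ha]
    have hs0 : 0 ≤ ∑ i ∈ s, w i := Finset.sum_nonneg fun i _ => hw i
    rcases (show w a ≤ 1 by linarith).eq_or_lt with h1 | h1
    · have hz : ∀ i ∈ s, w i = 0 :=
        (Finset.sum_eq_zero_iff_of_nonneg fun i _ => hw i).1 (by linarith)
      rw [Finset.sum_eq_zero fun i hi => by rw [hz i hi, zero_mul], h1]
      simp
    · have hp : 0 < 1 - w a := by linarith
      have key := ih (fun i => w i / (1 - w a)) (fun i => div_nonneg (hw i) hp.le)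
        (by rw [← Finset.sum_div, div_le_one hp]; linarith)
      have e : w a * x a + ∑ i ∈ s, w i * x i
          = w a * x a + (1 - w a) * ∑ i ∈ s, w i / (1 - w a) * x i := by
        rw [Finset.mul_sum]
        congr 1
        refine Finset.sum_congr rfl fun i _ => ?_
        field_simp
      rw [e]
      refine (hA.2.1 _ _ _ (hx a)
        (Finset.sum_nonneg fun i _ => mul_nonneg (div_nonneg (hw i) hp.le) (hx i))
        (hw a) h1.le).trans ?_
      gcongr
      refine (mul_le_mul_right key _).trans ?_
      rw [Finset.mul_sum]
      refine Finset.sum_le_sum fun i _ => ?_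
      rw [← mul_assoc, ← ENNReal.ofReal_mul hp.le, mul_div_cancel₀ _ hp.ne']

theorem youngConj_mono (A : ℝ → ℝ≥0∞) : Monotone (youngConj A) := by
  intro t t' h
  refine iSup₂_mono fun τ hτ => ?_
  gcongr

/-- A finite sum of suprema is bounded once all sums over choices are. -/
theorem ENNReal.sum_iSup_le {ι κ : Type*} [Nonempty κ] (s : Finset ι) (f : ι → κ → ℝ≥0∞)
    (C : ℝ≥0∞) (h : ∀ g : ι → κ, ∑ i ∈ s, f i (g i) ≤ C) : ∑ i ∈ s, ⨆ k, f i k ≤ C := by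
  classical
  suffices H : ∀ c₀ : ℝ≥0∞, (∀ g : ι → κ, c₀ + ∑ i ∈ s, f i (g i) ≤ C) →
      c₀ + ∑ i ∈ s, ⨆ k, f i k ≤ C by simpa using H 0 (by simpa using h)
  clear h
  induction s using Finset.induction_on with
  | empty => intro c₀ h; simpa using h
  | insert a s ha ih =>
    intro c₀ h
    rw [Finset.sum_insert ha, ← add_assoc, ENNReal.add_iSup, ENNReal.iSup_add]
    refine iSup_le fun k => ih _ fun g => ?_
    have := h (Function.update g a k)
    rw [Finset.sum_insert ha, Function.update_self, ← add_assoc] at this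
    refine le_of_eq_of_le ?_ this
    congr 1
    refine Finset.sum_congr rfl fun i hi => ?_
    rw [Function.update_of_ne (ne_of_mem_of_not_mem hi ha)]

/-- Discrete duality: a linear bound on the modular unit ball of `A` gives a modular bound
for the Young conjugate. -/
theorem IsYoung.sum_youngConj_le {A : ℝ → ℝ≥0∞} (hA : IsYoung A) (s : Finset ℕ)
    {W b t : ℕ → ℝ} {M ε : ℝ} (hW : ∀ j, 0 < W j) (ht0 : ∀ j, 0 ≤ t j)
    (hM : 0 < M) (hε0 : 0 ≤ ε) (hε1 : ε ≤ 1) (ht : ∀ j, t j * W j * M = ε * b j)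
    (hP : ∀ h : ℕ → ℝ, (∀ j, 0 ≤ h j) → ∑ j ∈ s, A (h j) * ENNReal.ofReal (W j) ≤ 1 →
      ∑ j ∈ s, h j * b j ≤ M) :
    ∑ j ∈ s, youngConj A (t j) * ENNReal.ofReal (W j) ≤ ENNReal.ofReal ε := by
  have e : ∀ j, youngConj A (t j) * ENNReal.ofReal (W j)
      = ⨆ τ : {τ : ℝ // 0 ≤ τ}, (ENNReal.ofReal (τ * t j) - A τ) * ENNReal.ofReal (W j) := by
    intro j
    rw [youngConj, iSup_subtype', ENNReal.iSup_mul]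
  simp_rw [e]
  have : Nonempty {τ : ℝ // 0 ≤ τ} := ⟨⟨0, le_rfl⟩⟩
  refine ENNReal.sum_iSup_le s _ _ fun g₀ => ?_
  let g : ℕ → ℝ := fun j => if A (g₀ j) ≤ ENNReal.ofReal (g₀ j * t j) then (g₀ j : ℝ) else 0
  have hg0 : ∀ j, 0 ≤ g j := fun j => by
    dsimp only [g]; split_ifs
    · exact (g₀ j).2
    · exact le_rfl
  have hgA : ∀ j, A (g j) ≤ ENNReal.ofReal (g j * t j) := fun j => by
    dsimp only [g]; split_ifs with h
    · exact h
    · simp [hA.zero]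
  have hgle : ∀ j, ENNReal.ofReal (g₀ j * t j) - A (g₀ j)
      ≤ ENNReal.ofReal (g j * t j) - A (g j) := fun j => by
    dsimp only [g]; split_ifs with h
    · exact le_rfl
    · rw [tsub_eq_zero_of_le (not_le.1 h).le]; exact zero_le
  have hfin : ∑ j ∈ s, A (g j) * ENNReal.ofReal (W j) ≠ ⊤ := by
    refine (ENNReal.sum_lt_top.2 fun j _ => ENNReal.mul_lt_top ?_ ENNReal.ofReal_lt_top).ne
    exact (hgA j).trans_lt ENNReal.ofReal_lt_top
  refine (Finset.sum_le_sum fun j _ => mul_le_mul_left (hgle j) _).trans ?_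
  have hadd : ∑ j ∈ s, (ENNReal.ofReal (g j * t j) - A (g j)) * ENNReal.ofReal (W j)
      + ∑ j ∈ s, A (g j) * ENNReal.ofReal (W j) = ENNReal.ofReal (∑ j ∈ s, g j * t j * W j) := by
    rw [← Finset.sum_add_distrib, ENNReal.ofReal_sum_of_nonneg fun j _ =>
      mul_nonneg (mul_nonneg (hg0 j) (ht0 j)) (hW j).le]
    refine Finset.sum_congr rfl fun j _ => ?_
    rw [← add_mul, tsub_add_cancel_of_le (hgA j),
      ← ENNReal.ofReal_mul (mul_nonneg (hg0 j) (ht0 j))]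
  have hsum : ∑ j ∈ s, g j * t j * W j = ε / M * ∑ j ∈ s, g j * b j := by
    rw [Finset.mul_sum]
    refine Finset.sum_congr rfl fun j _ => ?_
    rw [div_mul_eq_mul_div, eq_div_iff hM.ne']
    linear_combination g j * ht j
  refine (ENNReal.add_le_add_iff_right hfin).1 ?_
  rw [hadd, hsum]
  set S := (∑ j ∈ s, A (g j) * ENNReal.ofReal (W j)).toReal with hS
  rw [← ENNReal.ofReal_toReal hfin, ← hS, ← ENNReal.ofReal_add hε0 ENNReal.toReal_nonneg]
  refine ENNReal.ofReal_le_ofReal ?_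
  have hS0 : 0 ≤ S := ENNReal.toReal_nonneg
  rcases le_total S 1 with h1 | h1
  · have := hP g hg0 (by
      rw [← ENNReal.ofReal_toReal hfin, ← hS]; simpa using ENNReal.ofReal_le_ofReal h1)
    calc ε / M * ∑ j ∈ s, g j * b j ≤ ε / M * M := by gcongr
      _ = ε := div_mul_cancel₀ _ hM.ne'
      _ ≤ ε + S := by linarith
  · have hSp : 0 < S := by linarith
    have := hP (fun j => S⁻¹ * g j) (fun j => mul_nonneg (by positivity) (hg0 j)) (by
      calc ∑ j ∈ s, A (S⁻¹ * g j) * ENNReal.ofReal (W j)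
          ≤ ∑ j ∈ s, ENNReal.ofReal S⁻¹ * A (g j) * ENNReal.ofReal (W j) := by
            gcongr with j
            exact hA.scale (by positivity) (inv_le_one_of_one_le₀ h1) (hg0 j)
        _ = ENNReal.ofReal S⁻¹ * ENNReal.ofReal S := by
            rw [hS, ENNReal.ofReal_toReal hfin, Finset.mul_sum]; simp_rw [mul_assoc]
        _ ≤ 1 := by
            rw [← ENNReal.ofReal_mul (by positivity), inv_mul_cancel₀ hSp.ne']; simp)
    simp_rw [mul_assoc] at this
    rw [← Finset.mul_sum, inv_mul_le_iff₀ hSp] at this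
    calc ε / M * ∑ j ∈ s, g j * b j ≤ ε / M * (S * M) := by gcongr
      _ = ε * S := by field_simp
      _ ≤ 1 * S := by gcongr
      _ ≤ ε + S := by linarith

/-! ### Dyadic control of `Fk` -/

/-- Dyadic upper bound for the Young function `Fk` of order zero. -/
theorem Fk_zero_le_of_dyadic {n : ℕ} {s : ℝ} (hs : s < (n : ℝ) + 1) (A : ℝ → ℝ≥0∞) {t : ℝ}
    (ht : 0 < t) {B : ℝ≥0∞}
    (hB : ∀ N : ℕ, ∑ j ∈ Finset.range N,
      youngConj A (t * ((2 : ℝ) ^ (s - n - 1)) ^ j) * ENNReal.ofReal (((2 : ℝ) ^ j) ^ n) ≤ B) :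
    Fk n s 0 A t ≤ ENNReal.ofReal
      (((2 : ℝ) ^ (s - n - 1)) ^ (-1 - (n : ℝ) / ((n : ℝ) - s + 1))) * B := by
  set q : ℝ := (2 : ℝ) ^ (s - n - 1) with hq
  have hβ : 0 < (n : ℝ) - s + 1 := by linarith
  have hq0 : 0 < q := by positivity
  have hq1 : q < 1 := Real.rpow_lt_one_of_one_lt_of_neg (by norm_num) (by linarith)
  set p : ℝ := (n : ℝ) / ((n : ℝ) - s + 1) with hp
  have hp0 : 0 ≤ p := by positivity
  have hcover : Ioc 0 t ⊆ ⋃ j : ℕ, Ioc (t * q ^ (j + 1)) (t * q ^ j) := by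
    intro τ hτ
    obtain ⟨j, h1, h2⟩ := exists_nat_pow_near_of_lt_one (div_pos hτ.1 ht)
      ((div_le_one ht).2 hτ.2) hq0 hq1
    exact mem_iUnion.2 ⟨j, by rwa [lt_div_iff₀' ht] at h1, by rwa [div_le_iff₀' ht] at h2⟩
  have hpow : ∀ j : ℕ, (q ^ j) ^ (-p) = ((2 : ℝ) ^ j) ^ n := fun j => by
    rw [hq, ← Real.rpow_natCast, ← Real.rpow_natCast, ← Real.rpow_natCast, ← Real.rpow_mul,
      ← Real.rpow_mul, ← Real.rpow_mul]
    · congr 1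
      rw [hp]; field_simp; ring
    all_goals positivity
  have hreal : ∀ j : ℕ, t ^ p * ((t * q ^ (j + 1)) ^ (-1 - p) * (t * q ^ j))
      = q ^ (-1 - p) * ((2 : ℝ) ^ j) ^ n := fun j => by
    rw [← hpow j, pow_succ, ← mul_assoc t, Real.mul_rpow (by positivity) hq0.le,
      Real.mul_rpow ht.le (by positivity), sub_eq_add_neg, Real.rpow_add ht,
      Real.rpow_add (by positivity : 0 < q ^ j), Real.rpow_neg_one, Real.rpow_neg_one,
      Real.rpow_neg ht.le]
    have : 0 < t ^ p := by positivity
    field_simp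
  have hterm : ∀ j : ℕ, ENNReal.ofReal (t ^ p) * ∫⁻ τ in Ioc (t * q ^ (j + 1)) (t * q ^ j),
        youngConj A τ * ENNReal.ofReal (τ ^ (-1 - p))
      ≤ ENNReal.ofReal (q ^ (-1 - p)) *
        (youngConj A (t * q ^ j) * ENNReal.ofReal (((2 : ℝ) ^ j) ^ n)) := fun j => by
    calc _ ≤ ENNReal.ofReal (t ^ p) * ∫⁻ _ in Ioc (t * q ^ (j + 1)) (t * q ^ j),
        youngConj A (t * q ^ j) * ENNReal.ofReal ((t * q ^ (j + 1)) ^ (-1 - p)) := by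
          refine mul_le_mul_right ?_ _
          refine setLIntegral_mono' measurableSet_Ioc fun τ hτ => ?_
          gcongr ?_ * ENNReal.ofReal ?_
          · exact youngConj_mono A hτ.2
          · exact Real.rpow_le_rpow_of_nonpos (by positivity) hτ.1.le (by linarith)
      _ ≤ ENNReal.ofReal (t ^ p) *
          (youngConj A (t * q ^ j) * ENNReal.ofReal ((t * q ^ (j + 1)) ^ (-1 - p)) *
            ENNReal.ofReal (t * q ^ j)) := by
          rw [setLIntegral_const, Real.volume_Ioc]
          gcongr
          have : 0 < t * q ^ (j + 1) := by positivity
          linarith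
      _ = youngConj A (t * q ^ j) * ENNReal.ofReal
          (t ^ p * ((t * q ^ (j + 1)) ^ (-1 - p) * (t * q ^ j))) := by
          rw [ENNReal.ofReal_mul (by positivity : 0 ≤ t ^ p),
            ENNReal.ofReal_mul (by positivity : 0 ≤ (t * q ^ (j + 1)) ^ (-1 - p))]
          ring
      _ = _ := by
          rw [hreal, ENNReal.ofReal_mul (by positivity)]; ring
  have hexp : (n : ℝ) / ((n : ℝ) - s + ((0 : ℕ) : ℝ) + 1) = p := by simp [hp]
  rw [Fk, hexp]
  calc _ ≤ ENNReal.ofReal (t ^ p) * ∑' j : ℕ, ∫⁻ τ in Ioc (t * q ^ (j + 1)) (t * q ^ j),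
        youngConj A τ * ENNReal.ofReal (τ ^ (-1 - p)) := by
        gcongr
        exact (lintegral_mono_set hcover).trans (lintegral_iUnion_le _ _)
    _ ≤ ∑' j : ℕ, ENNReal.ofReal (q ^ (-1 - p)) *
        (youngConj A (t * q ^ j) * ENNReal.ofReal (((2 : ℝ) ^ j) ^ n)) := by
        rw [← ENNReal.tsum_mul_left]
        exact ENNReal.tsum_le_tsum hterm
    _ ≤ _ := by
        rw [ENNReal.tsum_mul_left]
        gcongr
        exact ENNReal.tsum_le_of_sum_range_le hB

/-! ### Geometric sums -/

/-- The terms of a decreasing geometric progression lying below `1` have bounded sum. -/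
theorem sum_geom_le_one {q : ℝ} (hq0 : 0 < q) (hq1 : q < 1) (N : ℕ) (x : ℝ) (hx : 0 ≤ x) :
    ∑ j ∈ Finset.range N, (if x * q ^ j ≤ 1 then x * q ^ j else 0) ≤ (1 - q)⁻¹ := by
  have hp : 0 < 1 - q := by linarith
  induction N generalizing x with
  | zero => simpa using hp.le
  | succ N ih =>
    rcases le_or_gt x 1 with h | h
    · calc _ ≤ ∑ j ∈ Finset.range (N + 1), q ^ j := by
            refine Finset.sum_le_sum fun j _ => ?_
            have : x * q ^ j ≤ 1 * q ^ j := by gcongr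
            split_ifs
            · linarith
            · positivity
        _ ≤ (1 - q)⁻¹ := by
            rw [← tsum_geometric_of_lt_one hq0.le hq1]
            exact (summable_geometric_of_lt_one hq0.le hq1).sum_le_tsum _ fun _ _ => by positivity
    · rw [Finset.sum_range_succ']
      have := ih (x * q) (by positivity)
      simp only [pow_zero, mul_one, not_le.2 h, if_false, add_zero]
      refine le_of_eq_of_le (Finset.sum_congr rfl fun j _ => ?_) this
      rw [pow_succ', mul_assoc]

/-- The terms of an increasing geometric progression lying below `1` have bounded sum. -/
theorem sum_geom_inv_le_one {q : ℝ} (hq0 : 0 < q) (hq1 : q < 1) (N : ℕ) (x : ℝ) (hx : 0 ≤ x) :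
    ∑ j ∈ Finset.range N, (if x * q⁻¹ ^ j ≤ 1 then x * q⁻¹ ^ j else 0) ≤ (1 - q)⁻¹ := by
  rw [← Finset.sum_range_reflect]
  refine le_of_eq_of_le (Finset.sum_congr rfl fun j hj => ?_)
    (sum_geom_le_one hq0 hq1 N (x * q⁻¹ ^ (N - 1)) (by positivity))
  have hjN : j ≤ N - 1 := by have := Finset.mem_range.1 hj; omega
  rw [mul_assoc, show q⁻¹ ^ (N - 1) * q ^ j = q⁻¹ ^ (N - 1 - j) by
    rw [pow_sub₀ _ (inv_ne_zero hq0.ne') hjN, inv_pow q j, inv_inv]]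

/-! ### The scale kernel -/

/-- The profile `min(z, 1) / z^σ`, measuring the interaction of a bump at unit scale with
increments of size `z`. -/
noncomputable def scaleKer (σ z : ℝ) : ℝ := min z 1 / z ^ σ

theorem scaleKer_nonneg {σ z : ℝ} (hz : 0 ≤ z) : 0 ≤ scaleKer σ z := by
  unfold scaleKer; positivity

theorem scaleKer_zero (σ : ℝ) : scaleKer σ 0 = 0 := by simp [scaleKer]

theorem scaleKer_of_le_one {σ z : ℝ} (hz : 0 < z) (h : z ≤ 1) :
    scaleKer σ z = z ^ (1 - σ) := by
  rw [scaleKer, min_eq_left h, Real.rpow_sub hz, Real.rpow_one]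

theorem scaleKer_of_one_le {σ z : ℝ} (h : 1 ≤ z) : scaleKer σ z = z ^ (-σ) := by
  rw [scaleKer, min_eq_right h, Real.rpow_neg (by linarith), one_div]

theorem measurable_scaleKer (σ : ℝ) : Measurable (scaleKer σ) := by
  unfold scaleKer; fun_prop

/-- The sum of the scale kernel over dyadic scales is uniformly bounded. -/
theorem sum_scaleKer_le {σ : ℝ} (hσ0 : 0 < σ) (hσ1 : σ < 1) {ρ a : ℝ} (hρ : 0 < ρ) (ha : 0 ≤ a)
    (N : ℕ) : ∑ j ∈ Finset.range N, scaleKer σ (a / (ρ * 2 ^ j)) ≤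
      (1 - (2 : ℝ) ^ (-(1 - σ)))⁻¹ + (1 - (2 : ℝ) ^ (-σ))⁻¹ := by
  have hq : ∀ b : ℝ, 0 < b → (2 : ℝ) ^ (-b) < 1 := fun b hb =>
    Real.rpow_lt_one_of_one_lt_of_neg (by norm_num) (by linarith)
  rcases ha.eq_or_lt with rfl | ha
  · simp only [zero_div, scaleKer_zero, Finset.sum_const_zero]
    have h1 := hq σ hσ0
    have h2 := hq (1 - σ) (by linarith)
    have h3 : 0 < 1 - (2 : ℝ) ^ (-(1 - σ)) := by linarith
    have h4 : 0 < 1 - (2 : ℝ) ^ (-σ) := by linarith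
    positivity
  refine le_trans ?_ (add_le_add
    (sum_geom_le_one (by positivity) (hq (1 - σ) (by linarith)) N ((a / ρ) ^ (1 - σ))
      (by positivity))
    (sum_geom_inv_le_one (by positivity) (hq σ hσ0) N ((a / ρ) ^ (-σ)) (by positivity)))
  rw [← Finset.sum_add_distrib]
  refine Finset.sum_le_sum fun j _ => ?_
  have hz : 0 < a / (ρ * 2 ^ j) := by positivity
  have e1 : (a / ρ) ^ (1 - σ) * ((2 : ℝ) ^ (-(1 - σ))) ^ j = (a / (ρ * 2 ^ j)) ^ (1 - σ) := by
    rw [← div_div, Real.div_rpow (x := a / ρ) (by positivity) (by positivity),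
      Real.rpow_neg (by norm_num), inv_pow, Real.rpow_pow_comm (by norm_num),
      ← div_eq_mul_inv]
  have e2 : (a / ρ) ^ (-σ) * ((2 : ℝ) ^ (-σ))⁻¹ ^ j = (a / (ρ * 2 ^ j)) ^ (-σ) := by
    rw [← div_div, Real.div_rpow (x := a / ρ) (by positivity) (by positivity),
      inv_pow, Real.rpow_pow_comm (by norm_num),
      ← div_eq_mul_inv]
  rw [e1, e2]
  rcases le_total (a / (ρ * 2 ^ j)) 1 with h | h
  · rw [scaleKer_of_le_one hz h, if_pos (Real.rpow_le_one hz.le h (by linarith))]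
    refine le_add_of_nonneg_right ?_
    split_ifs <;> positivity
  · rw [scaleKer_of_one_le h,
      if_pos (c := _ ^ (-σ) ≤ 1) (Real.rpow_le_one_of_one_le_of_nonpos h (by linarith))]
    · refine le_add_of_nonneg_left ?_
      split_ifs <;> positivity

/-- The singular kernel on `ℝⁿ` associated with `scaleKer` at scale `T`. -/
noncomputable def singKer (n : ℕ) (σ T : ℝ) (z : Euc n) : ℝ≥0∞ :=
  ENNReal.ofReal (scaleKer σ (‖z‖ / T)) / ENNReal.ofReal (‖z‖ ^ n)

theorem measurable_singKer (n : ℕ) (σ T : ℝ) : Measurable (singKer n σ T) := by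
  unfold singKer
  have := measurable_scaleKer σ
  fun_prop

/-- The integral of the singular kernel does not depend on the scale. -/
theorem lintegral_singKer (n : ℕ) (σ : ℝ) {T : ℝ} (hT : 0 < T) :
    ∫⁻ z, singKer n σ T z = ∫⁻ z, singKer n σ 1 z := by
  have e : ∀ z : Euc n, singKer n σ T z
      = ENNReal.ofReal ((T ^ n)⁻¹) * singKer n σ 1 (T⁻¹ • z) := fun z => by
    rw [singKer, singKer, norm_smul, norm_inv, Real.norm_of_nonneg hT.le, div_one, mul_pow,
      ENNReal.ofReal_mul (by positivity), inv_mul_eq_div, inv_pow, ENNReal.div_eq_inv_mul,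
      ENNReal.div_eq_inv_mul, ENNReal.mul_inv (by right; simp)
        (by left; exact ENNReal.ofReal_ne_top), ← mul_assoc, ← mul_assoc,
      ENNReal.mul_inv_cancel, one_mul]
    · simpa using by positivity
    · exact ENNReal.ofReal_ne_top
  simp_rw [e]
  have hm : Measurable fun z : Euc n => T⁻¹ • z := by fun_prop
  rw [lintegral_const_mul (f := fun z : Euc n => singKer n σ 1 (T⁻¹ • z)) _
      ((measurable_singKer n σ 1).comp hm),
    ← lintegral_map (measurable_singKer n σ 1) hm,
    Measure.map_addHaar_smul _ (inv_ne_zero hT.ne'), lintegral_smul_measure, smul_eq_mul,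
    ← mul_assoc, ← ENNReal.ofReal_mul (by positivity)]
  simp [abs_of_pos hT, hT.ne']

theorem lintegral_singKer_lt_top {n : ℕ} (hn : 0 < n) {σ : ℝ} (hσ0 : 0 < σ) (hσ1 : σ < 1) :
    ∫⁻ z, singKer n σ 1 z < ⊤ := by
  have : NeZero n := ⟨hn.ne'⟩
  have hI : Integrable (fun z : Euc n => scaleKer σ ‖z‖ / ‖z‖ ^ n) := by
    refine (integrable_fun_norm_addHaar (f := fun y => scaleKer σ y / y ^ n) volume).2 ?_
    have hm : Measurable fun y : ℝ =>
        y ^ (Module.finrank ℝ (Euc n) - 1) • (scaleKer σ y / y ^ n) := by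
      have := measurable_scaleKer σ
      fun_prop
    have e : ∀ y : ℝ, 0 < y → y ^ (Module.finrank ℝ (Euc n) - 1) • (scaleKer σ y / y ^ n)
        = scaleKer σ y * y⁻¹ := fun y hy => by
      obtain ⟨k, rfl⟩ := Nat.exists_eq_succ_of_ne_zero hn.ne'
      simp only [finrank_euclideanSpace, Fintype.card_fin, Nat.succ_eq_add_one,
        Nat.add_sub_cancel, smul_eq_mul]
      field_simp
      ring
    rw [← Ioc_union_Ioi_eq_Ioi (zero_le_one' ℝ)]
    refine IntegrableOn.union ?_ ?_
    · have h1 : IntegrableOn (fun y : ℝ => y ^ (-σ)) (Ioc 0 1) :=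
        (intervalIntegrable_iff_integrableOn_Ioc_of_le zero_le_one).1
          (intervalIntegral.intervalIntegrable_rpow' (by linarith))
      refine h1.congr_fun (fun y hy => ?_) measurableSet_Ioc
      simp only
      rw [e y hy.1, scaleKer_of_le_one hy.1 hy.2, ← Real.rpow_neg_one, ← Real.rpow_add hy.1]
      congr 1; ring
    · refine (integrableOn_Ioi_rpow_of_lt (a := -σ - 1) (by linarith) zero_lt_one).congr_fun
        (fun y hy => ?_) measurableSet_Ioi
      have hy' : (1 : ℝ) < y := hy
      simp only
      rw [e y (by linarith), scaleKer_of_one_le hy'.le, ← Real.rpow_neg_one,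
        ← Real.rpow_add (by linarith)]
      congr 1
  refine lt_of_le_of_lt (lintegral_mono fun z => ?_) hI.lintegral_lt_top
  rcases eq_or_ne z 0 with rfl | hz
  · simp [singKer, scaleKer_zero]
  · rw [singKer, div_one, ENNReal.ofReal_div_of_pos (by positivity)]

/-! ### Modular estimate for superpositions over dyadic scales -/

/-- The double integral of the singular kernel over pairs with one point in a fixed ball. -/
theorem lintegral_pairs_singKer_le (n : ℕ) (σ : ℝ) {T : ℝ} (hT : 0 < T) :
    ∫⁻ z : Euc n × Euc n, ((closedBall 0 (2 * T)).indicator (fun _ => 1) z.1 +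
        (closedBall 0 (2 * T)).indicator (fun _ => 1) z.2) * singKer n σ T (z.1 - z.2)
        ∂(volume.prod volume) =
      2 * (∫⁻ z, singKer n σ 1 z) * volume (closedBall (0 : Euc n) 2) * ENNReal.ofReal (T ^ n) := by
  have hK : Measurable fun z : Euc n × Euc n => singKer n σ T (z.1 - z.2) :=
    (measurable_singKer n σ T).comp (measurable_fst.sub measurable_snd)
  have hi : Measurable ((closedBall (0 : Euc n) (2 * T)).indicator fun _ => (1 : ℝ≥0∞)) :=
    measurable_const.indicator measurableSet_closedBall
  have hvol : volume (closedBall (0 : Euc n) (2 * T))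
      = ENNReal.ofReal (T ^ n) * volume (closedBall (0 : Euc n) 2) := by
    rw [mul_comm 2 T, Measure.addHaar_closedBall_mul_of_pos _ _ hT]; simp
  have hm1 : Measurable fun z : Euc n × Euc n => (closedBall 0 (2 * T)).indicator
      (fun _ => (1 : ℝ≥0∞)) z.1 * singKer n σ T (z.1 - z.2) := (hi.comp measurable_fst).mul hK
  have hm2 : Measurable fun z : Euc n × Euc n => (closedBall 0 (2 * T)).indicator
      (fun _ => (1 : ℝ≥0∞)) z.2 * singKer n σ T (z.1 - z.2) := (hi.comp measurable_snd).mul hK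
  have h1 : ∫⁻ z : Euc n × Euc n, (closedBall 0 (2 * T)).indicator (fun _ => 1) z.1 *
      singKer n σ T (z.1 - z.2) ∂(volume.prod volume)
      = volume (closedBall (0 : Euc n) (2 * T)) * ∫⁻ z, singKer n σ 1 z := by
    rw [lintegral_prod _ hm1.aemeasurable]
    have : ∀ x : Euc n, ∫⁻ y : Euc n, (closedBall 0 (2 * T)).indicator (fun _ => 1) x *
        singKer n σ T (x - y) = (closedBall 0 (2 * T)).indicator (fun _ => 1) x *
          ∫⁻ z, singKer n σ 1 z := fun x => by
      rw [lintegral_const_mul' _ _ (by by_cases h : x ∈ closedBall 0 (2 * T) <;> simp [h]),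
        lintegral_sub_left_eq_self (fun z => singKer n σ T z), lintegral_singKer n σ hT]
    simp_rw [this]
    rw [lintegral_mul_const _ hi, lintegral_indicator_const measurableSet_closedBall, one_mul]
  have h2 : ∫⁻ z : Euc n × Euc n, (closedBall 0 (2 * T)).indicator (fun _ => 1) z.2 *
      singKer n σ T (z.1 - z.2) ∂(volume.prod volume)
      = volume (closedBall (0 : Euc n) (2 * T)) * ∫⁻ z, singKer n σ 1 z := by
    rw [lintegral_prod_symm _ hm2.aemeasurable]
    have : ∀ y : Euc n, ∫⁻ x : Euc n, (closedBall 0 (2 * T)).indicator (fun _ => 1) y *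
        singKer n σ T (x - y) = (closedBall 0 (2 * T)).indicator (fun _ => 1) y *
          ∫⁻ z, singKer n σ 1 z := fun y => by
      rw [lintegral_const_mul' _ _ (by by_cases h : y ∈ closedBall 0 (2 * T) <;> simp [h]),
        lintegral_sub_right_eq_self (fun z => singKer n σ T z), lintegral_singKer n σ hT]
    simp_rw [this]
    rw [lintegral_mul_const _ hi, lintegral_indicator_const measurableSet_closedBall, one_mul]
  simp_rw [add_mul]
  rw [lintegral_add_left hm1, h1, h2, hvol]
  ring

/-- Modular bound for a field whose increments are dominated by a superposition of dyadic bumps: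
the seminorm is controlled by the modular of the coefficients. -/
theorem exists_Jfun_le_one_of_dyadic {n : ℕ} (hn : 0 < n) {σ : ℝ} (hσ0 : 0 < σ) (hσ1 : σ < 1)
    {A : ℝ → ℝ≥0∞} (hA : IsYoung A) {ι : Type} [Fintype ι] :
    ∃ C : ℝ, 0 < C ∧ ∀ (v : Euc n → ι → ℝ) (ρ : ℝ) (N : ℕ) (h : ℕ → ℝ), 0 < ρ →
      (∀ j, 0 ≤ h j) →
      (∀ x y, Real.sqrt (∑ i, (v x i - v y i) ^ 2) ≤ ∑ j ∈ Finset.range N,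
        h j * ((ρ * 2 ^ j) ^ σ * (if ‖x‖ ≤ 2 * (ρ * 2 ^ j) ∨ ‖y‖ ≤ 2 * (ρ * 2 ^ j) then
          min (‖x - y‖ / (ρ * 2 ^ j)) 1 else 0))) →
      ∑ j ∈ Finset.range N, A (h j) * ENNReal.ofReal ((ρ * 2 ^ j) ^ n) ≤ 1 →
      Jfun n σ A (fun x i => v x i / C) ≤ 1 := by
  set κ : ℝ := (1 - (2 : ℝ) ^ (-(1 - σ)))⁻¹ + (1 - (2 : ℝ) ^ (-σ))⁻¹ with hκdef
  have hκ : 0 < κ := by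
    have hq : ∀ b : ℝ, 0 < b → 0 < 1 - (2 : ℝ) ^ (-b) := fun b hb => sub_pos.2 <|
      Real.rpow_lt_one_of_one_lt_of_neg (by norm_num) (by linarith)
    exact add_pos (inv_pos.2 (hq _ (by linarith))) (inv_pos.2 (hq _ hσ0))
  set V : ℝ≥0∞ := 2 * (∫⁻ z, singKer n σ 1 z) * volume (closedBall (0 : Euc n) 2) with hV
  have hVtop : V ≠ ⊤ := (ENNReal.mul_lt_top (ENNReal.mul_lt_top (by simp)
    (lintegral_singKer_lt_top hn hσ0 hσ1)) measure_closedBall_lt_top).ne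
  set C' : ℝ := max 1 (V.toReal / κ) with hC'
  have hC'1 : 1 ≤ C' := le_max_left _ _
  have hC'0 : 0 < C' := by linarith
  refine ⟨κ * C', by positivity, fun v ρ N h hρ hh hv hmod => ?_⟩
  let χ : ℕ → Euc n → Euc n → ℝ := fun j x y =>
    if ‖x‖ ≤ 2 * (ρ * 2 ^ j) ∨ ‖y‖ ≤ 2 * (ρ * 2 ^ j) then 1 else 0
  have hχ0 : ∀ j x y, 0 ≤ χ j x y := fun j x y => by dsimp only [χ]; split_ifs <;> simp
  have hχ1 : ∀ j x y, χ j x y ≤ 1 := fun j x y => by dsimp only [χ]; split_ifs <;> simp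
  let w : Euc n → Euc n → ℕ → ℝ := fun x y j =>
    κ⁻¹ * (scaleKer σ (‖x - y‖ / (ρ * 2 ^ j)) * χ j x y)
  have hk0 : ∀ (x y : Euc n) (j : ℕ), 0 ≤ scaleKer σ (‖x - y‖ / (ρ * 2 ^ j)) := fun x y j =>
    scaleKer_nonneg (by positivity)
  have hw0 : ∀ x y j, 0 ≤ w x y j := fun x y j =>
    mul_nonneg (by positivity) (mul_nonneg (hk0 x y j) (hχ0 j x y))
  have hw1 : ∀ x y, ∑ j ∈ Finset.range N, w x y j ≤ 1 := fun x y => by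
    simp only [w]
    rw [← Finset.mul_sum, inv_mul_le_iff₀ hκ, mul_one]
    refine (Finset.sum_le_sum fun j _ => ?_).trans
      (sum_scaleKer_le hσ0 hσ1 hρ (norm_nonneg (x - y)) N)
    exact mul_le_of_le_one_right (hk0 x y j) (hχ1 j x y)
  let Ψ : ℕ → Euc n × Euc n → ℝ≥0∞ := fun j z =>
    ((closedBall 0 (2 * (ρ * 2 ^ j))).indicator (fun _ => 1) z.1 +
        (closedBall 0 (2 * (ρ * 2 ^ j))).indicator (fun _ => 1) z.2) *
          singKer n σ (ρ * 2 ^ j) (z.1 - z.2)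
  have hΨm : ∀ j, Measurable (Ψ j) := fun j => by
    have hi : Measurable ((closedBall (0 : Euc n) (2 * (ρ * 2 ^ j))).indicator
      fun _ => (1 : ℝ≥0∞)) := measurable_const.indicator measurableSet_closedBall
    exact ((hi.comp measurable_fst).add (hi.comp measurable_snd)).mul
      ((measurable_singKer n σ _).comp (measurable_fst.sub measurable_snd))
  have hpt : ∀ x y : Euc n,
      A (Real.sqrt (∑ i, (v x i / (κ * C') - v y i / (κ * C')) ^ 2) / ‖x - y‖ ^ σ) /
        ENNReal.ofReal (‖x - y‖ ^ (n : ℝ)) ≤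
      ∑ j ∈ Finset.range N, ENNReal.ofReal (C'⁻¹ * κ⁻¹) * A (h j) * Ψ j (x, y) := fun x y => by
    have hsq : Real.sqrt (∑ i, (v x i / (κ * C') - v y i / (κ * C')) ^ 2)
        = (κ * C')⁻¹ * Real.sqrt (∑ i, (v x i - v y i) ^ 2) := by
      rw [← Real.sqrt_sq (by positivity : 0 ≤ (κ * C')⁻¹), ← Real.sqrt_mul (by positivity),
        Finset.mul_sum]
      congr 1
      refine Finset.sum_congr rfl fun i _ => ?_
      rw [← mul_pow]; congr 1; ring
    have harg : Real.sqrt (∑ i, (v x i / (κ * C') - v y i / (κ * C')) ^ 2) / ‖x - y‖ ^ σ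
        ≤ C'⁻¹ * ∑ j ∈ Finset.range N, w x y j * h j := by
      rw [hsq]
      calc (κ * C')⁻¹ * Real.sqrt (∑ i, (v x i - v y i) ^ 2) / ‖x - y‖ ^ σ
          ≤ (κ * C')⁻¹ * (∑ j ∈ Finset.range N,
            h j * ((ρ * 2 ^ j) ^ σ * (if ‖x‖ ≤ 2 * (ρ * 2 ^ j) ∨ ‖y‖ ≤ 2 * (ρ * 2 ^ j) then
              min (‖x - y‖ / (ρ * 2 ^ j)) 1 else 0))) / ‖x - y‖ ^ σ := by
            gcongr; exact hv x y
        _ = C'⁻¹ * ∑ j ∈ Finset.range N, w x y j * h j := by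
            rw [Finset.mul_sum, Finset.mul_sum, Finset.sum_div]
            refine Finset.sum_congr rfl fun j _ => ?_
            simp only [w, χ, scaleKer]
            have hT : 0 < ρ * 2 ^ j := by positivity
            rw [Real.div_rpow (norm_nonneg _) hT.le]
            have : 0 < (ρ * 2 ^ j) ^ σ := by positivity
            split_ifs
            · field_simp
            · simp
    have hA1 : A (Real.sqrt (∑ i, (v x i / (κ * C') - v y i / (κ * C')) ^ 2) / ‖x - y‖ ^ σ)
        ≤ ENNReal.ofReal C'⁻¹ * ∑ j ∈ Finset.range N, ENNReal.ofReal (w x y j) * A (h j) := by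
      refine (hA.mono (by positivity) harg).trans ?_
      refine (hA.scale (by positivity) (inv_le_one_of_one_le₀ hC'1)
        (Finset.sum_nonneg fun j _ => mul_nonneg (hw0 x y j) (hh j))).trans ?_
      gcongr
      exact hA.jensen _ _ _ (hw0 x y) hh (hw1 x y)
    refine (ENNReal.div_le_div_right hA1 _).trans ?_
    rw [Finset.mul_sum, div_eq_mul_inv, Finset.sum_mul]
    refine Finset.sum_le_sum fun j _ => ?_
    have hwj : ENNReal.ofReal (w x y j) * (ENNReal.ofReal (‖x - y‖ ^ (n : ℝ)))⁻¹
        ≤ ENNReal.ofReal κ⁻¹ * Ψ j (x, y) := by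
      simp only [w, Ψ, singKer, χ, Real.rpow_natCast, div_eq_mul_inv (ENNReal.ofReal _)]
      rw [ENNReal.ofReal_mul (by positivity : 0 ≤ κ⁻¹), ENNReal.ofReal_mul (hk0 x y j),
        mul_assoc, mul_right_comm, mul_comm (_ * _) (ENNReal.ofReal (ite _ _ _))]
      refine mul_le_mul_right (mul_le_mul_left ?_ _) _
      by_cases h1 : ‖x‖ ≤ 2 * (ρ * 2 ^ j) <;> by_cases h2 : ‖y‖ ≤ 2 * (ρ * 2 ^ j) <;>
        simp [h1, h2]
    rw [ENNReal.ofReal_mul (inv_nonneg.2 hC'0.le)]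
    calc _ = ENNReal.ofReal C'⁻¹ * A (h j) *
          (ENNReal.ofReal (w x y j) * (ENNReal.ofReal (‖x - y‖ ^ (n : ℝ)))⁻¹) := by ring
      _ ≤ ENNReal.ofReal C'⁻¹ * A (h j) * (ENNReal.ofReal κ⁻¹ * Ψ j (x, y)) := by gcongr
      _ = _ := by ring
  calc Jfun n σ A (fun x i => v x i / (κ * C'))
      ≤ ∫⁻ x : Euc n, ∫⁻ y : Euc n,
        ∑ j ∈ Finset.range N, ENNReal.ofReal (C'⁻¹ * κ⁻¹) * A (h j) * Ψ j (x, y) :=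
        lintegral_mono fun x => lintegral_mono fun y => hpt x y
    _ = ∑ j ∈ Finset.range N, ENNReal.ofReal (C'⁻¹ * κ⁻¹) * A (h j) *
          ∫⁻ z, Ψ j z ∂(volume.prod volume) := by
        rw [← lintegral_prod (fun z => ∑ j ∈ Finset.range N,
          ENNReal.ofReal (C'⁻¹ * κ⁻¹) * A (h j) * Ψ j z)
          (Finset.measurable_fun_sum _ fun j _ => (hΨm j).const_mul _).aemeasurable,
          lintegral_finsetSum _ fun j _ => (hΨm j).const_mul _]
        exact Finset.sum_congr rfl fun j _ => lintegral_const_mul _ (hΨm j)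
    _ = ENNReal.ofReal (C'⁻¹ * κ⁻¹) * V *
          ∑ j ∈ Finset.range N, A (h j) * ENNReal.ofReal ((ρ * 2 ^ j) ^ n) := by
        rw [Finset.mul_sum]
        refine Finset.sum_congr rfl fun j _ => ?_
        rw [lintegral_pairs_singKer_le n σ (by positivity), ← hV]
        ring
    _ ≤ ENNReal.ofReal (C'⁻¹ * κ⁻¹) * V * 1 := by gcongr
    _ ≤ 1 := by
        rw [mul_one, ← ENNReal.ofReal_toReal hVtop, ← ENNReal.ofReal_mul (by positivity)]
        rw [← ENNReal.ofReal_one]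
        refine ENNReal.ofReal_le_ofReal ?_
        rw [mul_assoc, inv_mul_le_iff₀ hC'0, mul_one, inv_mul_eq_div]
        exact le_max_right _ _

/-! ### Partial derivatives of smooth test functions -/

/-- Integration by parts for iterated derivatives; the directions are reversed, so that no
symmetry of the derivatives is needed. -/
theorem integral_mul_iteratedFDeriv {n : ℕ} (h : ℕ) : ∀ (u φ : Euc n → ℝ) (v : Fin h → Euc n),
    ContDiff ℝ (⊤ : ℕ∞) u → HasCompactSupport u → ContDiff ℝ (⊤ : ℕ∞) φ → HasCompactSupport φ →
    ∫ x, u x * iteratedFDeriv ℝ h φ x v =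
      (-1 : ℝ) ^ h * ∫ x, iteratedFDeriv ℝ h u x (v ∘ Fin.rev) * φ x := by
  induction h with
  | zero => intro u φ v _ _ _ _; simp
  | succ h ih =>
    intro u φ v hu hcu hφ hcφ
    have hDφ : ContDiff ℝ (⊤ : ℕ∞) (fun y => iteratedFDeriv ℝ h φ y (Fin.tail v)) :=
      (ContinuousMultilinearMap.apply ℝ (fun _ : Fin h => Euc n) ℝ (Fin.tail v)).contDiff.comp
        (hφ.iteratedFDeriv_right (by norm_cast))
    have hDu : ContDiff ℝ (⊤ : ℕ∞) (fun x => fderiv ℝ u x (v 0)) :=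
      (hu.fderiv_right (by norm_cast)).clm_apply contDiff_const
    have hcDu : HasCompactSupport (fun x => fderiv ℝ u x (v 0)) := hcu.fderiv_apply ℝ (v 0)
    have hcont : Continuous (fun x => iteratedFDeriv ℝ (h + 1) φ x v) :=
      (ContinuousMultilinearMap.apply ℝ (fun _ : Fin (h + 1) => Euc n) ℝ v).continuous.comp
        (hφ.continuous_iteratedFDeriv (by norm_cast; exact le_top))
    have h1 : ∀ x, iteratedFDeriv ℝ (h + 1) φ x v =
        fderiv ℝ (fun y => iteratedFDeriv ℝ h φ y (Fin.tail v)) x (v 0) := by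
      intro x
      rw [iteratedFDeriv_succ_apply_left]
      have hd : DifferentiableAt ℝ (iteratedFDeriv ℝ h φ) x :=
        ((hφ.iteratedFDeriv_right (m := (⊤ : ℕ∞)) (by norm_cast)).differentiable (by simp)) x
      have := ((ContinuousMultilinearMap.apply ℝ (fun _ : Fin h => Euc n) ℝ
        (Fin.tail v)).hasFDerivAt.comp x hd.hasFDerivAt).fderiv
      have h2 := congrArg (fun L => L (v 0)) this
      exact h2.symm
    have h3 : ∫ x, u x * iteratedFDeriv ℝ (h + 1) φ x v =
        -∫ x, fderiv ℝ u x (v 0) * iteratedFDeriv ℝ h φ x (Fin.tail v) := by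
      simp_rw [h1]
      refine integral_mul_fderiv_eq_neg_fderiv_mul_of_integrable ?_ ?_ ?_
        (fun x _ => hu.differentiable (by simp) x) (fun x _ => hDφ.differentiable (by simp) x)
      · exact (hDu.continuous.mul hDφ.continuous).integrable_of_hasCompactSupport hcDu.mul_right
      · simp_rw [← h1]
        exact (hu.continuous.mul hcont).integrable_of_hasCompactSupport hcu.mul_right
      · exact (hu.continuous.mul hDφ.continuous).integrable_of_hasCompactSupport hcu.mul_right
    rw [h3, ih _ φ (Fin.tail v) hDu hcDu hφ hcφ, pow_succ, mul_neg_one, neg_mul]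
    congr 3
    ext x
    congr 1
    rw [iteratedFDeriv_succ_apply_right]
    have h5 := ContinuousLinearMap.iteratedFDeriv_comp_left (ContinuousLinearMap.apply ℝ ℝ (v 0))
      (f := fderiv ℝ u) (x := x) (n := (⊤ : ℕ∞)) (i := h)
      (hu.fderiv_right (by norm_cast)).contDiffAt (by norm_cast; exact le_top)
    have h6 := congrArg (fun L => L (Fin.tail v ∘ Fin.rev)) h5
    refine h6.trans ?_
    have e1 : Fin.init (v ∘ Fin.rev) = Fin.tail v ∘ Fin.rev := by
      ext1 i
      simp [Fin.init, Fin.tail, Fin.rev_castSucc]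
    have e2 : (v ∘ Fin.rev) (Fin.last h) = v 0 := by simp
    rw [e1, e2]
    rfl

/-- The iterated partial derivatives of a smooth function. -/
noncomputable def partials {n : ℕ} (u : Euc n → ℝ) (h : ℕ) (x : Euc n) (d : Fin h → Fin n) : ℝ :=
  iteratedFDeriv ℝ h u x (fun i => EuclideanSpace.single (d (Fin.rev i)) (1 : ℝ))

theorem contDiff_partials {n : ℕ} {u : Euc n → ℝ} (hu : ContDiff ℝ (⊤ : ℕ∞) u) (h : ℕ)
    (d : Fin h → Fin n) : ContDiff ℝ (⊤ : ℕ∞) (fun x => partials u h x d) :=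
  (ContinuousMultilinearMap.apply ℝ (fun _ : Fin h => Euc n) ℝ _).contDiff.comp
    (hu.iteratedFDeriv_right (by norm_cast))

theorem support_partials_subset {n : ℕ} (u : Euc n → ℝ) (h : ℕ) (d : Fin h → Fin n) :
    Function.support (fun x => partials u h x d) ⊆ tsupport u := by
  intro x hx
  refine support_iteratedFDeriv_subset (𝕜 := ℝ) h ?_
  intro h0
  exact hx (by simp [partials, h0])

theorem hasWeakDerivs_partials {n : ℕ} {u : Euc n → ℝ} (hu : ContDiff ℝ (⊤ : ℕ∞) u)
    (hcu : HasCompactSupport u) (m : ℕ) : HasWeakDerivs n m u (partials u) := by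
  refine ⟨fun x d => by simp [partials], fun h _ d => ⟨?_, fun φ hφ hcφ => ?_⟩⟩
  · exact (contDiff_partials hu h d).continuous.locallyIntegrable
  · rw [integral_mul_iteratedFDeriv h u φ _ hu hcu hφ hcφ]
    rfl

theorem decayFrom_partials {n : ℕ} {u : Euc n → ℝ} (hcu : HasCompactSupport u) (k m : ℕ) :
    DecayFrom n k m (partials u) := by
  intro h _ _ t ht
  refine (measure_mono ?_).trans_lt (IsCompact.measure_lt_top (μ := volume) hcu)
  intro x hx
  by_contra hxu
  have h0 : ∀ d, partials u h x d = 0 := fun d => by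
    by_contra h0
    exact hxu (support_partials_subset u h d h0)
  simp only [mem_ofPred_eq, gradLen, h0] at hx
  simp at hx
  linarith

/-- A compactly supported smooth bump has Lipschitz derivatives at unit scale. -/
theorem exists_sqrt_partials_sub_le {n : ℕ} {η : Euc n → ℝ} (hη : ContDiff ℝ (⊤ : ℕ∞) η)
    (hsupp : tsupport η ⊆ closedBall 0 2) (m : ℕ) :
    ∃ L : ℝ, 0 < L ∧ ∀ x y, Real.sqrt (∑ d, (partials η m x d - partials η m y d) ^ 2) ≤
      L * (if ‖x‖ ≤ 2 ∨ ‖y‖ ≤ 2 then min ‖x - y‖ 1 else 0) := by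
  have hc : HasCompactSupport η :=
    (isCompact_closedBall (0 : Euc n) 2).of_isClosed_subset (isClosed_tsupport η) hsupp
  let G : Euc n → EuclideanSpace ℝ (Fin m → Fin n) := fun x => WithLp.toLp 2 (partials η m x)
  have hG : ContDiff ℝ (⊤ : ℕ∞) G := by
    rw [contDiff_euclidean]
    exact fun d => contDiff_partials hη m d
  have hG0 : ∀ x, ¬ ‖x‖ ≤ 2 → G x = 0 := by
    intro x hx
    ext d
    by_contra h0
    have := hsupp (support_partials_subset η m d h0)
    simp at this
    exact hx this
  have hcG : HasCompactSupport G := HasCompactSupport.intro (isCompact_closedBall (0 : Euc n) 2)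
    (fun x hx => hG0 x (by simpa using hx))
  obtain ⟨K, hK⟩ := hG.lipschitzWith_of_hasCompactSupport hcG (by simp)
  obtain ⟨B, hB⟩ := hG.continuous.bounded_above_of_compact_support hcG
  have hnorm : ∀ x y, Real.sqrt (∑ d, (partials η m x d - partials η m y d) ^ 2) =
      ‖G x - G y‖ := by
    intro x y
    rw [EuclideanSpace.norm_eq]
    simp [G]
  have hB0 : 0 ≤ B := (norm_nonneg _).trans (hB 0)
  refine ⟨max (K : ℝ) (2 * B) + 1, by positivity, fun x y => ?_⟩
  rw [hnorm]
  split_ifs with h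
  · have h1 : ‖G x - G y‖ ≤ K * ‖x - y‖ := by
      simpa [dist_eq_norm] using hK.dist_le_mul x y
    have h2 : ‖G x - G y‖ ≤ 2 * B := by
      have := norm_sub_le (G x) (G y)
      linarith [hB x, hB y]
    rcases min_choice ‖x - y‖ 1 with h3 | h3 <;> rw [h3]
    · refine h1.trans (mul_le_mul_of_nonneg_right ?_ (norm_nonneg _))
      linarith [le_max_left (K : ℝ) (2 * B)]
    · linarith [le_max_right (K : ℝ) (2 * B)]
  · push Not at h
    rw [hG0 x (by linarith [h.1]), hG0 y (by linarith [h.2])]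
    simp

theorem partials_sum_dilation {n : ℕ} {η : Euc n → ℝ} (hη : ContDiff ℝ (⊤ : ℕ∞) η) (N : ℕ)
    (a T : ℕ → ℝ) (m : ℕ) (x : Euc n) (d : Fin m → Fin n) :
    partials (fun x => ∑ j ∈ Finset.range N, a j * η ((T j)⁻¹ • x)) m x d =
      ∑ j ∈ Finset.range N, a j * ((T j)⁻¹) ^ m * partials η m ((T j)⁻¹ • x) d := by
  have hcomp : ∀ j, ContDiff ℝ (⊤ : ℕ∞) (fun x : Euc n => η ((T j)⁻¹ • x)) := fun j =>
    hη.comp (contDiff_const_smul _)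
  have hcd : ∀ j, ContDiffAt ℝ m (fun x : Euc n => η ((T j)⁻¹ • x)) x := fun j =>
    ((hcomp j).of_le (by norm_cast; exact le_top)).contDiffAt
  unfold partials
  rw [iteratedFDeriv_fun_sum_apply fun j _ => contDiffAt_const.mul (hcd j),
    _root_.sum_apply]
  refine Finset.sum_congr rfl fun j _ => ?_
  have h1 := iteratedFDeriv_const_smul_apply' (a := a j) (hcd j)
  simp only [smul_eq_mul] at h1
  rw [h1, smul_apply, smul_eq_mul, mul_assoc]
  congr 1
  have h2 := ContinuousLinearMap.iteratedFDeriv_comp_right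
    ((T j)⁻¹ • ContinuousLinearMap.id ℝ (Euc n)) (f := η) (n := (⊤ : ℕ∞)) hη x
    (i := m) (by norm_cast; exact le_top)
  have h3 : (η ∘ ⇑((T j)⁻¹ • ContinuousLinearMap.id ℝ (Euc n))) =
    fun x => η ((T j)⁻¹ • x) := by ext; simp
  rw [h3] at h2
  rw [h2]
  simp [ContinuousMultilinearMap.compContinuousLinearMap_apply,
    ContinuousMultilinearMap.map_smul_univ]

theorem sqrt_sum_sq_sum_le {ι κ : Type*} [Fintype ι] (s : Finset κ) (f : κ → ι → ℝ) :
    Real.sqrt (∑ i, (∑ j ∈ s, f j i) ^ 2) ≤ ∑ j ∈ s, Real.sqrt (∑ i, (f j i) ^ 2) := by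
  have h := norm_sum_le s (fun j => (WithLp.toLp 2 (f j) : EuclideanSpace ℝ ι))
  simpa [EuclideanSpace.norm_eq] using h

theorem sqrt_sum_sq_mul {ι : Type*} [Fintype ι] {a : ℝ} (ha : 0 ≤ a) (f : ι → ℝ) :
    Real.sqrt (∑ i, (a * f i) ^ 2) = a * Real.sqrt (∑ i, (f i) ^ 2) := by
  simp_rw [mul_pow]
  rw [← Finset.mul_sum, Real.sqrt_mul (sq_nonneg a), Real.sqrt_sq ha]

/-- A smooth compactly supported function which is a coordinate near the origin. -/
theorem exists_smooth_coord {n : ℕ} (i : Fin n) : ∃ η : Euc n → ℝ, ContDiff ℝ (⊤ : ℕ∞) η ∧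
    tsupport η ⊆ closedBall 0 2 ∧ ∀ x ∈ ball (0 : Euc n) 1, η x = x i := by
  let f : ContDiffBump (0 : Euc n) := ⟨1, 2, by norm_num, by norm_num⟩
  refine ⟨fun x => f x * x i, ?_, ?_, fun x hx => ?_⟩
  · exact f.contDiff.mul (EuclideanSpace.proj (𝕜 := ℝ) i).contDiff
  · exact (tsupport_mul_subset_left).trans (f.tsupport_eq).le
  · change f x * x i = x i
    rw [f.one_of_mem_closedBall (ball_subset_closedBall hx), one_mul]

theorem average_abs_coord_pos {n : ℕ} (i : Fin n) :
    0 < ⨍ x in ball (0 : Euc n) 1, |x i| := by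
  have hcont : Continuous (fun x : Euc n => |x i|) := by fun_prop
  rw [setAverage_eq, smul_eq_mul]
  refine mul_pos (inv_pos.2 ?_) ?_
  · exact ENNReal.toReal_pos (measure_ball_pos volume _ one_pos).ne' measure_ball_lt_top.ne
  · rw [setIntegral_pos_iff_support_of_nonneg_ae (Eventually.of_forall fun x => abs_nonneg _)
      ((hcont.continuousOn.integrableOn_compact (isCompact_closedBall 0 1)).mono_set
        ball_subset_closedBall)]
    refine IsOpen.measure_pos _ (IsOpen.inter ?_ isOpen_ball) ?_
    · exact hcont.isOpen_support
    · refine ⟨EuclideanSpace.single i (1 / 2), ?_, ?_⟩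
      · simp
      · simp; norm_num

theorem volume_real_ball {n : ℕ} {ρ : ℝ} (hρ : 0 < ρ) :
    volume.real (ball (0 : Euc n) ρ) = ρ ^ n * volume.real (ball (0 : Euc n) 1) := by
  rw [Measure.real, Measure.addHaar_ball_of_pos _ _ hρ, ENNReal.toReal_mul,
    ENNReal.toReal_ofReal (by positivity), finrank_euclideanSpace, Fintype.card_fin]
  rfl

/-- Mean oscillation of a multiple of a coordinate over a centred ball. -/
theorem average_osc_coord {n : ℕ} (i : Fin n) {u : Euc n → ℝ} {Q ρ : ℝ} (hQ : 0 ≤ Q) (hρ : 0 < ρ)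
    (hu : ∀ x ∈ ball (0 : Euc n) ρ, u x = Q * x i) :
    ⨍ y in ball (0 : Euc n) ρ, |u y - ⨍ z in ball (0 : Euc n) ρ, u z| =
      Q * ρ * ⨍ x in ball (0 : Euc n) 1, |x i| := by
  have hmean : ⨍ z in ball (0 : Euc n) ρ, u z = 0 := by
    rw [setAverage_eq, setIntegral_congr_fun measurableSet_ball hu]
    have h := (Measure.measurePreserving_neg (volume : Measure (Euc n))).setIntegral_preimage_emb
      (MeasurableEquiv.neg _).measurableEmbedding (fun x => Q * x i) (ball (0 : Euc n) ρ)
    have h2 : (Neg.neg : Euc n → Euc n) ⁻¹' ball (0 : Euc n) ρ = ball 0 ρ := by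
      ext x; simp
    rw [h2] at h
    simp only [PiLp.neg_apply, mul_neg] at h
    rw [integral_neg] at h
    have : ∫ x in ball (0 : Euc n) ρ, Q * x i = 0 := by linarith
    rw [this, smul_zero]
  rw [hmean, setAverage_eq, setAverage_eq, smul_eq_mul, smul_eq_mul]
  have h1 : ∫ y in ball (0 : Euc n) ρ, |u y - 0| = Q * ∫ y in ball (0 : Euc n) ρ, |y i| := by
    rw [← integral_const_mul]
    refine setIntegral_congr_fun measurableSet_ball fun x hx => ?_
    simp only [sub_zero]
    rw [hu x hx, abs_mul, abs_of_nonneg hQ]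
  rw [h1]
  have h2 := Measure.setIntegral_comp_smul_of_pos (volume : Measure (Euc n))
    (fun x : Euc n => |x i|) (ball (0 : Euc n) 1) hρ
  rw [_root_.smul_ball hρ.ne', smul_zero, mul_one, Real.norm_of_nonneg hρ.le] at h2
  simp only [PiLp.smul_apply, smul_eq_mul, abs_mul, abs_of_pos hρ, finrank_euclideanSpace,
    Fintype.card_fin] at h2
  rw [integral_const_mul] at h2
  have hv : volume.real (ball (0 : Euc n) ρ) = ρ ^ n * volume.real (ball (0 : Euc n) 1) :=
    volume_real_ball hρ
  have hv1 : 0 < volume.real (ball (0 : Euc n) 1) :=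
    ENNReal.toReal_pos (measure_ball_pos volume _ one_pos).ne' measure_ball_lt_top.ne
  rw [hv]
  have hρn : 0 < ρ ^ n := by positivity
  field_simp
  field_simp at h2
  linear_combination (-Q) * h2

theorem fracSem_le_of_Jfun_le_one {n : ℕ} {σ : ℝ} {A : ℝ → ℝ≥0∞} {ι : Type} [Fintype ι]
    {v : Euc n → ι → ℝ} {lam : ℝ} (hlam : 0 < lam)
    (h : Jfun n σ A (fun x i => v x i / lam) ≤ 1) : fracSem n σ A v ≤ ENNReal.ofReal lam :=
  sInf_le ⟨lam, ⟨hlam, h⟩, rfl⟩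

/-- Superpositions of dilated bumps that are admissible for the embedding, and linear near the
origin. -/
theorem exists_dyadic_test {n : ℕ} (hn : 0 < n) {s : ℝ} (hs : 1 < s) (hs2 : ∀ m : ℕ, s ≠ (m : ℝ))
    {A : ℝ → ℝ≥0∞} (hA : IsYoung A) : ∃ Λ : ℝ, 0 < Λ ∧ ∀ (ρ : ℝ) (N : ℕ) (h : ℕ → ℝ), 0 < ρ →
      (∀ j, 0 ≤ h j) →
      ∑ j ∈ Finset.range N, A (h j) * ENNReal.ofReal ((ρ * 2 ^ j) ^ n) ≤ 1 →
      ∃ (u : Euc n → ℝ) (D : (h : ℕ) → Euc n → (Fin h → Fin n) → ℝ),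
        HasWeakDerivs n ⌊s⌋₊ u D ∧ DecayFrom n 1 ⌊s⌋₊ D ∧
        fracSem n (s - (⌊s⌋₊ : ℝ)) A (D ⌊s⌋₊) ≤ ENNReal.ofReal Λ ∧
        ∀ x ∈ ball (0 : Euc n) ρ,
          u x = (∑ j ∈ Finset.range N, h j * (ρ * 2 ^ j) ^ (s - 1)) * x ⟨0, hn⟩ := by
  obtain ⟨η, hη, hsupp, hcoord⟩ := exists_smooth_coord (⟨0, hn⟩ : Fin n)
  set m := ⌊s⌋₊ with hm
  set σ := s - (m : ℝ) with hσ
  have hσ0 : 0 < σ := sub_pos.2 ((Nat.floor_le (by linarith)).lt_of_ne (hs2 m).symm)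
  have hσ1 : σ < 1 := by have := Nat.lt_floor_add_one s; rw [← hm] at this; linarith
  obtain ⟨L, hL0, hL⟩ := exists_sqrt_partials_sub_le hη hsupp m
  obtain ⟨C, hC0, hC⟩ := exists_Jfun_le_one_of_dyadic hn hσ0 hσ1 hA (ι := Fin m → Fin n)
  refine ⟨L * C, by positivity, fun ρ N h hρ hh hsum => ?_⟩
  set T : ℕ → ℝ := fun j => ρ * 2 ^ j with hT
  have hT0 : ∀ j, 0 < T j := fun j => by positivity
  let u : Euc n → ℝ := fun x => ∑ j ∈ Finset.range N, (h j * T j ^ s) * η ((T j)⁻¹ • x)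
  have hu : ContDiff ℝ (⊤ : ℕ∞) u := ContDiff.sum fun j _ =>
    contDiff_const.mul (hη.comp (contDiff_const_smul _))
  have hcη : HasCompactSupport η :=
    (isCompact_closedBall (0 : Euc n) 2).of_isClosed_subset (isClosed_tsupport η) hsupp
  have hη0 : ∀ x : Euc n, 2 < ‖x‖ → η x = 0 := fun x hx => by
    by_contra h0
    have := hsupp (subset_tsupport _ h0)
    simp at this
    linarith
  have hcu : HasCompactSupport u := by
    refine HasCompactSupport.intro (isCompact_closedBall (0 : Euc n) (2 * T N)) fun x hx => ?_
    refine Finset.sum_eq_zero fun j hj => ?_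
    rw [hη0, mul_zero]
    have hx' : 2 * T N < ‖x‖ := by simpa using hx
    rw [norm_smul, norm_inv, Real.norm_of_nonneg (hT0 j).le, lt_inv_mul_iff₀ (hT0 j)]
    have hTj : T j ≤ T N := by
      simp only [hT]
      gcongr
      · norm_num
      · exact (Finset.mem_range.1 hj).le
    linarith
  refine ⟨u, partials u, hasWeakDerivs_partials hu hcu m, decayFrom_partials hcu 1 m, ?_,
    fun x hx => ?_⟩
  · refine fracSem_le_of_Jfun_le_one (by positivity) ?_
    have key := hC (fun x d => partials u m x d / L) ρ N h hρ hh ?_ hsum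
    · simpa only [div_div] using key
    · intro x y
      have hdiff : ∀ d, partials u m x d / L - partials u m y d / L =
          ∑ j ∈ Finset.range N, (h j * T j ^ σ / L) *
            (partials η m ((T j)⁻¹ • x) d - partials η m ((T j)⁻¹ • y) d) := by
        intro d
        simp only [u]
        rw [partials_sum_dilation hη N (fun j => h j * T j ^ s) T,
          partials_sum_dilation hη N (fun j => h j * T j ^ s) T, ← sub_div,
          ← Finset.sum_sub_distrib, Finset.sum_div]
        refine Finset.sum_congr rfl fun j _ => ?_
        have : T j ^ s = T j ^ σ * T j ^ m := by
          rw [← Real.rpow_natCast, ← Real.rpow_add (hT0 j)]; simp [hσ]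
        rw [this, inv_pow]
        have := (pow_pos (hT0 j) m).ne'
        field_simp
      simp_rw [hdiff]
      refine (sqrt_sum_sq_sum_le (Finset.range N) (fun j d => (h j * T j ^ σ / L) *
            (partials η m ((T j)⁻¹ • x) d - partials η m ((T j)⁻¹ • y) d))).trans
        (Finset.sum_le_sum fun j _ => ?_)
      have hpos : 0 ≤ h j * T j ^ σ / L :=
        div_nonneg (mul_nonneg (hh j) (Real.rpow_nonneg (hT0 j).le _)) hL0.le
      rw [sqrt_sum_sq_mul hpos]
      refine (mul_le_mul_of_nonneg_left (hL _ _) hpos).trans (le_of_eq ?_)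
      simp only [← smul_sub, norm_smul, norm_inv, Real.norm_of_nonneg (hT0 j).le,
        inv_mul_eq_div, div_le_iff₀ (hT0 j)]
      rw [← mul_assoc, div_mul_cancel₀ _ hL0.ne', mul_assoc]
  · simp only [u]
    rw [Finset.sum_mul]
    refine Finset.sum_congr rfl fun j _ => ?_
    have hmem : (T j)⁻¹ • x ∈ ball (0 : Euc n) 1 := by
      simp only [mem_ball, dist_zero_right] at hx ⊢
      rw [norm_smul, norm_inv, Real.norm_of_nonneg (hT0 j).le, inv_mul_lt_iff₀ (hT0 j), mul_one]
      refine hx.trans_le ?_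
      exact le_mul_of_one_le_right hρ.le (one_le_pow₀ one_le_two)
    rw [hcoord _ hmem, PiLp.smul_apply, smul_eq_mul, Real.rpow_sub_one (hT0 j).ne']
    field_simp

/-! ### Optimality -/

theorem le_rcInv_or_eq_zero {F : ℝ → ℝ≥0∞} {v : ℝ≥0∞} {τ₀ : ℝ}
    (h : ∀ τ, 0 ≤ τ → τ ≤ τ₀ → F τ ≤ v) : rcInv F v = 0 ∨ τ₀ ≤ rcInv F v := by
  rcases Set.eq_empty_or_nonempty {τ : ℝ | 0 ≤ τ ∧ v < F τ} with he | hne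
  · left; rw [rcInv, he, Real.sInf_empty]
  · right
    refine le_csInf hne fun τ hτ => ?_
    by_contra hlt
    exact absurd hτ.2 (not_lt.2 (h τ hτ.1 (not_le.1 hlt).le))

theorem psiK_zero_le_of_Fk_le {n : ℕ} {s : ℝ} {A : ℝ → ℝ≥0∞} {r τ₀ : ℝ} (hr : 0 < r) (hτ₀ : 0 < τ₀)
    (h : ∀ τ, 0 < τ → τ ≤ τ₀ → Fk n s 0 A τ ≤ ENNReal.ofReal (r ^ (-(n : ℝ)))) :
    psiK n s 0 A r ≤ (r ^ ((n : ℝ) - s) * τ₀)⁻¹ := by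
  have h' : ∀ τ, 0 ≤ τ → τ ≤ τ₀ → Fk n s 0 A τ ≤ ENNReal.ofReal (r ^ (-(n : ℝ))) := by
    intro τ hτ0 hτ
    rcases hτ0.eq_or_lt with rfl | hpos
    · simp [Fk]
    · exact h τ hpos hτ
  have hrp : 0 < r ^ ((n : ℝ) - s) := Real.rpow_pos_of_pos hr _
  simp only [psiK, Nat.cast_zero, add_zero]
  rcases le_rcInv_or_eq_zero h' with h0 | hle
  · rw [h0, mul_zero, inv_zero]; positivity
  · exact inv_anti₀ (by positivity) (by gcongr)

/-- A bound for all dyadic superpositions controls `F_0` near the origin. -/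
theorem Fk_zero_le_of_duality {n : ℕ} {s : ℝ} (hs : s < (n : ℝ) + 1) {A : ℝ → ℝ≥0∞}
    (hA : IsYoung A) {ρ M ε : ℝ} (hρ : 0 < ρ) (hM : 0 < M) (hε0 : 0 < ε) (hε1 : ε ≤ 1)
    (hP : ∀ (N : ℕ) (h : ℕ → ℝ), (∀ j, 0 ≤ h j) →
      ∑ j ∈ Finset.range N, A (h j) * ENNReal.ofReal ((ρ * 2 ^ j) ^ n) ≤ 1 →
      ∑ j ∈ Finset.range N, h j * (ρ * 2 ^ j) ^ (s - 1) ≤ M) :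
    Fk n s 0 A (ε * (ρ ^ (s - 1 - n) / M)) ≤
      ENNReal.ofReal (((2 : ℝ) ^ (s - n - 1)) ^ (-1 - (n : ℝ) / ((n : ℝ) - s + 1)) *
        (ε * (ρ ^ n)⁻¹)) := by
  rw [ENNReal.ofReal_mul (by positivity)]
  refine Fk_zero_le_of_dyadic hs A (by positivity) fun N => ?_
  have hρn : 0 < ρ ^ n := by positivity
  have key := hA.sum_youngConj_le (Finset.range N) (W := fun j => (ρ * 2 ^ j) ^ n)
    (b := fun j => (ρ * 2 ^ j) ^ (s - 1))
    (t := fun j => ε * (ρ ^ (s - 1 - n) / M) * ((2 : ℝ) ^ (s - n - 1)) ^ j)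
    (fun j => by positivity) (fun j => by positivity) hM hε0.le hε1 (fun j => ?_) (hP N)
  · rw [ENNReal.ofReal_mul hε0.le, ← mul_comm (ENNReal.ofReal (ρ ^ n)⁻¹)]
    refine le_trans (le_of_eq ?_) (mul_le_mul_right key _)
    rw [Finset.mul_sum]
    refine Finset.sum_congr rfl fun j _ => ?_
    rw [mul_left_comm, ← ENNReal.ofReal_mul (by positivity), mul_pow, inv_mul_cancel_left₀ hρn.ne']
  · have h1 : ρ ^ (s - 1 - n) * ((2 : ℝ) ^ (s - n - 1)) ^ j * (ρ * 2 ^ j) ^ n =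
        (ρ * 2 ^ j) ^ (s - 1) := by
      rw [← Real.rpow_natCast ((2 : ℝ) ^ (s - n - 1)) j, ← Real.rpow_mul two_pos.le,
        mul_comm (s - n - 1), Real.rpow_mul two_pos.le, Real.rpow_natCast,
        show s - (n : ℝ) - 1 = s - 1 - n by ring,
        ← Real.mul_rpow hρ.le (by positivity), ← Real.rpow_natCast (ρ * 2 ^ j) n,
        ← Real.rpow_add (by positivity)]
      simp
    rw [← h1]
    field_simp

/-- Optimality of `𝓛^{ψ_{s,A}}(ℝⁿ)` as a Campanato target of
`V^{s,A}_{d,1}(ℝⁿ)`: any admissible Campanato target `φ` satisfies `ψ_{s,A} ≲ φ`. -/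
theorem stmt7 (n : ℕ) (hn : 0 < n) (s : ℝ) (hs : s ∈ Set.Ioo (1 : ℝ) ((n : ℝ) + 1))
    (hs2 : ∀ m : ℕ, s ≠ (m : ℝ)) (A : ℝ → ℝ≥0∞) (hA : IsYoung A)
    (hint : IntCondK n s 0 A) (φ : ℝ → ℝ) (hφ : Admissible φ) (c : ℝ) (hc : 0 < c)
    (hemb : ∀ (u : Euc n → ℝ) (D : (h : ℕ) → Euc n → (Fin h → Fin n) → ℝ),
      HasWeakDerivs n ⌊s⌋₊ u D → DecayFrom n 1 ⌊s⌋₊ D →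
      fracSem n (s - (⌊s⌋₊ : ℝ)) A (D ⌊s⌋₊) < ⊤ →
      campSem n φ u ≤ ENNReal.ofReal c * fracSem n (s - (⌊s⌋₊ : ℝ)) A (D ⌊s⌋₊)) :
    ∃ c' : ℝ, 0 < c' ∧ ∀ r : ℝ, 0 < r → psiK n s 0 A r ≤ c' * φ r := by
  obtain ⟨hs1, hsn⟩ := hs
  obtain ⟨Λ, hΛ, htest⟩ := exists_dyadic_test hn hs1 hs2 hA
  set θ := ⨍ x in ball (0 : Euc n) 1, |x ⟨0, hn⟩| with hθ
  have hθ0 : 0 < θ := average_abs_coord_pos _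
  set ω := volume.real (ball (0 : Euc n) 1) with hω
  have hω0 : 0 < ω :=
    ENNReal.toReal_pos (measure_ball_pos volume _ one_pos).ne' measure_ball_lt_top.ne
  set κ := ω ^ ((n : ℝ)⁻¹) with hκ
  have hκ0 : 0 < κ := Real.rpow_pos_of_pos hω0 _
  have hκn : κ ^ n = ω := Real.rpow_inv_natCast_pow hω0.le hn.ne'
  set CF := ((2 : ℝ) ^ (s - n - 1)) ^ (-1 - (n : ℝ) / ((n : ℝ) - s + 1)) with hCF
  have hCF0 : 0 < CF := by positivity
  set ε := min 1 (CF * ω)⁻¹ with hε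
  have hε0 : 0 < ε := lt_min one_pos (by positivity)
  refine ⟨c * Λ / (ε * θ * κ ^ ((n : ℝ) - s)), by positivity, fun r hr => ?_⟩
  obtain ⟨ρ, hρ, rfl⟩ : ∃ ρ, 0 < ρ ∧ ρ * κ = r := ⟨r / κ, by positivity, by field_simp⟩
  have hφ0 : 0 < φ (ρ * κ) := hφ.1 _ hr
  have hvol : (volume (ball (0 : Euc n) ρ)).toReal ^ ((n : ℝ)⁻¹) = ρ * κ := by
    change (volume.real (ball (0 : Euc n) ρ)) ^ ((n : ℝ)⁻¹) = ρ * κ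
    rw [volume_real_ball hρ, ← hω, ← hκn, ← mul_pow, Real.pow_rpow_inv_natCast hr.le hn.ne']
  set M := c * Λ * φ (ρ * κ) / (θ * ρ) with hM
  have hM0 : 0 < M := by positivity
  have hP : ∀ (N : ℕ) (h : ℕ → ℝ), (∀ j, 0 ≤ h j) →
      ∑ j ∈ Finset.range N, A (h j) * ENNReal.ofReal ((ρ * 2 ^ j) ^ n) ≤ 1 →
      ∑ j ∈ Finset.range N, h j * (ρ * 2 ^ j) ^ (s - 1) ≤ M := by
    intro N h hh hsum
    obtain ⟨u, D, hD, hdec, hfrac, hu⟩ := htest ρ N h hρ hh hsum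
    set Q := ∑ j ∈ Finset.range N, h j * (ρ * 2 ^ j) ^ (s - 1) with hQ
    have hQ0 : 0 ≤ Q := Finset.sum_nonneg fun j _ => mul_nonneg (hh j) (by positivity)
    have hosc : ENNReal.ofReal (oscQuot n φ u 0 ρ) ≤ ENNReal.ofReal (c * Λ) := by
      rw [ENNReal.ofReal_mul hc.le]
      calc ENNReal.ofReal (oscQuot n φ u 0 ρ) ≤ campSem n φ u :=
            le_iSup₂_of_le (0 : Euc n) ρ (le_iSup_of_le hρ le_rfl)
        _ ≤ _ := hemb u D hD hdec (hfrac.trans_lt ENNReal.ofReal_lt_top)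
        _ ≤ _ := by gcongr
    rw [ENNReal.ofReal_le_ofReal_iff (by positivity), oscQuot, hvol,
      average_osc_coord ⟨0, hn⟩ hQ0 hρ hu, inv_mul_le_iff₀ hφ0, ← hθ] at hosc
    rw [hM, le_div_iff₀ (by positivity)]
    linarith
  have hnpow : (ρ * κ) ^ (-(n : ℝ)) = (ρ ^ n)⁻¹ * ω⁻¹ := by
    rw [Real.rpow_neg hr.le, Real.rpow_natCast, mul_pow, hκn, mul_inv]
  have hF : ∀ τ, 0 < τ → τ ≤ ε * (ρ ^ (s - 1 - n) / M) →
      Fk n s 0 A τ ≤ ENNReal.ofReal ((ρ * κ) ^ (-(n : ℝ))) := by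
    intro τ hτ0 hτ
    have ht0 : 0 < ρ ^ (s - 1 - n) / M := by positivity
    have hle : τ / (ρ ^ (s - 1 - n) / M) ≤ ε := (div_le_iff₀ ht0).2 hτ
    have key := Fk_zero_le_of_duality hsn hA hρ hM0 (div_pos hτ0 ht0)
      (hle.trans (min_le_left _ _)) hP
    rw [div_mul_cancel₀ _ ht0.ne'] at key
    refine key.trans (ENNReal.ofReal_le_ofReal ?_)
    rw [hnpow, ← hCF, ← mul_assoc, mul_comm (ρ ^ n)⁻¹]
    refine mul_le_mul_of_nonneg_right ?_ (by positivity)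
    calc CF * (τ / (ρ ^ (s - 1 - n) / M)) ≤ CF * (CF * ω)⁻¹ := by
          gcongr
          exact hle.trans (min_le_right _ _)
      _ = ω⁻¹ := by field_simp
  refine (psiK_zero_le_of_Fk_le hr (by positivity) hF).trans (le_of_eq ?_)
  have hρs : ρ ^ ((n : ℝ) - s) * ρ ^ (s - 1 - n) * ρ = 1 := by
    rw [← Real.rpow_add hρ, ← Real.rpow_add_one hρ.ne']
    simp
  have hρ1 : 0 < ρ ^ ((n : ℝ) - s) := by positivity
  have hρ2 : 0 < ρ ^ (s - 1 - (n : ℝ)) := by positivity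
  have hκ1 : 0 < κ ^ ((n : ℝ) - s) := by positivity
  rw [Real.mul_rpow hρ.le hκ0.le, hM]
  field_simp
  linear_combination (-1 : ℝ) * hρs
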